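/- Let K be a number field of degree n = [K:ℚ] ≥ 2 whose ring of integers 𝓞_K is a principal ideal domain (equivalently, a unique factorization domain). Then the following are equivalent: (1) every prime number of ℤ is an irreducible element of 𝓞_K; (2) every squarefree natural number d ≥ 2 is a Lehmer number over K, and every prime number of ℤ is normal over K. -/

import Mathlib

open NumberField

/-- The generalized totient function `φ_K(d)`: the cardinality of the unit group of
`𝓞_K / d𝓞_K`. -/
noncomputable def phiK (K : Type*) [Field K] [NumberField K] (d : ℕ) : ℕ :=
  Nat.card ((𝓞 K ⧸ Ideal.span {(d : 𝓞 K)})ˣ)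

/-- `d` is a Lehmer number over `K`: `φ_K(d) ∣ d^n - 1` iff `d` is irreducible in `𝓞_K`,
where `n = [K:ℚ]`. -/
def IsLehmer (K : Type*) [Field K] [NumberField K] (d : ℕ) : Prop :=
  phiK K d ∣ d ^ (Module.finrank ℚ K) - 1 ↔ Irreducible (d : 𝓞 K)

/-- `d` is normal over `K`: `φ_K(d)/φ(d)` divides `(d^n - 1)/(d - 1)`,
where `n = [K:ℚ]`. -/
def IsNormalNum (K : Type*) [Field K] [NumberField K] (d : ℕ) : Prop :=
  phiK K d / Nat.totient d ∣ (d ^ (Module.finrank ℚ K) - 1) / (d - 1)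

theorem card_quotient_span_natCast (K : Type*) [Field K] [NumberField K] (d : ℕ) :
    Nat.card (𝓞 K ⧸ Ideal.span {(d : 𝓞 K)}) = d ^ Module.finrank ℚ K := by
  have h : Ideal.absNorm (Ideal.span {(d : 𝓞 K)}) = d ^ Module.finrank ℚ K := by
    rw [Ideal.absNorm_span_singleton, ← RingOfIntegers.rank K]
    have := Algebra.norm_algebraMap (S := 𝓞 K) (d : ℤ)
    rw [map_natCast] at this
    rw [this, Int.natAbs_pow, Int.natAbs_natCast]
  rw [← h, Ideal.absNorm_apply, Submodule.cardQuot_apply]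

theorem phiK_one (K : Type*) [Field K] [NumberField K] : phiK K 1 = 1 := by
  have : Subsingleton (𝓞 K ⧸ Ideal.span {((1 : ℕ) : 𝓞 K)}) := by
    rw [Nat.cast_one, Ideal.span_singleton_one]
    infer_instance
  exact Nat.card_unique

theorem phiK_mul (K : Type*) [Field K] [NumberField K] {a b : ℕ} (h : a.Coprime b) :
    phiK K (a * b) = phiK K a * phiK K b := by
  have hc : IsCoprime (Ideal.span {(a : 𝓞 K)}) (Ideal.span {(b : 𝓞 K)}) := by
    rw [Ideal.isCoprime_span_singleton_iff]
    exact h.cast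
  have e := Ideal.quotientMulEquivQuotientProd _ _ hc
  rw [Ideal.span_singleton_mul_span_singleton, ← Nat.cast_mul] at e
  rw [phiK, phiK, phiK, ← Nat.card_prod]
  exact Nat.card_congr ((Units.mapEquiv e.toMulEquiv).trans MulEquiv.prodUnits).toEquiv

theorem phiK_of_prime {K : Type*} [Field K] [NumberField K] {p : ℕ}
    (hp : p ≠ 0) (h : Prime (p : 𝓞 K)) : phiK K p = p ^ Module.finrank ℚ K - 1 := by
  have h0 : (p : 𝓞 K) ≠ 0 := by exact_mod_cast hp
  have : (Ideal.span {(p : 𝓞 K)}).IsPrime := (Ideal.span_singleton_prime h0).2 h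
  have : (Ideal.span {(p : 𝓞 K)}).IsMaximal :=
    this.isMaximal (by simpa [Ideal.span_singleton_eq_bot] using hp)
  let := Ideal.Quotient.field (Ideal.span {(p : 𝓞 K)})
  rw [phiK, Nat.card_units, card_quotient_span_natCast]

theorem totient_dvd_phiK {K : Type*} [Field K] [NumberField K] {p : ℕ} (hp : p.Prime)
    (hK : Module.finrank ℚ K ≠ 0) : p.totient ∣ phiK K p := by
  have hcard := card_quotient_span_natCast K p
  have : Nontrivial (𝓞 K ⧸ Ideal.span {(p : 𝓞 K)}) := by
    have : Finite (𝓞 K ⧸ Ideal.span {(p : 𝓞 K)}) :=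
      Nat.finite_of_card_ne_zero (by rw [hcard]; exact pow_ne_zero _ hp.ne_zero)
    rw [← Finite.one_lt_card_iff_nontrivial, hcard]
    exact Nat.one_lt_pow hK hp.one_lt
  have : Fact p.Prime := ⟨hp⟩
  have : CharP (𝓞 K ⧸ Ideal.span {(p : 𝓞 K)}) p := by
    refine (CharP.charP_iff_prime_eq_zero hp).2 ?_
    rw [← map_natCast (Ideal.Quotient.mk (Ideal.span {(p : 𝓞 K)})), Ideal.Quotient.eq_zero_iff_mem]
    exact Ideal.mem_span_singleton_self _
  let f : ZMod p →+* 𝓞 K ⧸ Ideal.span {(p : 𝓞 K)} := ZMod.castHom dvd_rfl _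
  have := Subgroup.card_dvd_of_injective (Units.map f.toMonoidHom)
    (Units.map_injective (f := f.toMonoidHom) f.injective)
  rwa [Nat.card_eq_fintype_card, ZMod.card_units_eq_totient] at this

theorem half_lt_prod_one_sub_inv_sq (N : ℕ) :
    (1 / 2 : ℚ) < ∏ m ∈ Finset.Icc (2 : ℕ) (N + 1), (1 - 1 / (m : ℚ) ^ 2) := by
  have h : ∏ m ∈ Finset.Icc (2 : ℕ) (N + 1), (1 - 1 / (m : ℚ) ^ 2) = ((N : ℚ) + 2) / (2 * (N + 1)) := by
    induction N with
    | zero => simp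
    | succ N ih =>
      rw [Finset.prod_Icc_succ_top (by omega), ih]
      push_cast
      field_simp
      ring
  rw [h, div_lt_div_iff₀ (by norm_num) (by positivity)]
  linarith

theorem prod_pow_lt_two_mul_prod_pow_sub_one {n : ℕ} (hn : 2 ≤ n) (S : Finset ℕ)
    (hS : ∀ m ∈ S, 2 ≤ m) : ∏ m ∈ S, m ^ n < 2 * ∏ m ∈ S, (m ^ n - 1) := by
  have hsub : S ⊆ Finset.Icc 2 (S.sup id + 1) := fun m hm ↦
    Finset.mem_Icc.2 ⟨hS m hm, (Finset.le_sup (f := id) hm).trans (Nat.le_succ _)⟩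
  have hsq : ∀ m : ℕ, 2 ≤ m → 0 ≤ 1 - 1 / (m : ℚ) ^ 2 := fun m hm ↦ by
    have : (1 : ℚ) ≤ (m : ℚ) ^ 2 := one_le_pow₀ (by exact_mod_cast (by omega : 1 ≤ m))
    exact sub_nonneg.2 (div_le_one_of_le₀ this (by positivity))
  have h1 : (1 / 2 : ℚ) < ∏ m ∈ S, (1 - 1 / (m : ℚ) ^ n) := calc
    (1 / 2 : ℚ) < ∏ m ∈ Finset.Icc 2 (S.sup id + 1), (1 - 1 / (m : ℚ) ^ 2) :=
      half_lt_prod_one_sub_inv_sq _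
    _ ≤ ∏ m ∈ S, (1 - 1 / (m : ℚ) ^ 2) := by
      rw [← Finset.prod_sdiff hsub]
      refine mul_le_of_le_one_left (Finset.prod_nonneg fun m hm ↦ hsq m (hS m hm)) ?_
      refine Finset.prod_le_one (fun m hm ↦ hsq m ?_) fun m _ ↦ ?_
      · exact (Finset.mem_Icc.1 (Finset.mem_sdiff.1 hm).1).1
      · exact sub_le_self _ (by positivity)
    _ ≤ ∏ m ∈ S, (1 - 1 / (m : ℚ) ^ n) := by
      refine Finset.prod_le_prod (fun m hm ↦ hsq m (hS m hm)) fun m hm ↦ ?_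
      have : (1 : ℚ) ≤ m := by exact_mod_cast (by have := hS m hm; omega : 1 ≤ m)
      gcongr
  have hpos : (0 : ℚ) < ∏ m ∈ S, (m : ℚ) ^ n := Finset.prod_pos fun m hm ↦ by
    have : 0 < m := by have := hS m hm; omega
    positivity
  have h2 : ∏ m ∈ S, ((m : ℚ) ^ n - 1) =
      (∏ m ∈ S, (1 - 1 / (m : ℚ) ^ n)) * ∏ m ∈ S, (m : ℚ) ^ n := by
    rw [← Finset.prod_mul_distrib]
    refine Finset.prod_congr rfl fun m hm ↦ ?_
    have : (m : ℚ) ≠ 0 := by have := hS m hm; exact_mod_cast (by omega : m ≠ 0)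
    field_simp
  have h3 : ((∏ m ∈ S, (m ^ n - 1) : ℕ) : ℚ) = ∏ m ∈ S, ((m : ℚ) ^ n - 1) := by
    rw [Nat.cast_prod]
    refine Finset.prod_congr rfl fun m hm ↦ ?_
    rw [Nat.cast_sub (Nat.one_le_pow _ _ (by have := hS m hm; omega))]
    push_cast
    rfl
  have : ((∏ m ∈ S, m ^ n : ℕ) : ℚ) < ((2 * ∏ m ∈ S, (m ^ n - 1) : ℕ) : ℚ) := by
    rw [Nat.cast_mul, h3, h2]
    push_cast
    nlinarith
  exact_mod_cast this

theorem phiK_eq_prod_of_squarefree (K : Type*) [Field K] [NumberField K] {d : ℕ}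
    (hd : Squarefree d) : phiK K d = ∏ p ∈ d.primeFactors, phiK K p := by
  have key : ∀ S : Finset ℕ, (∀ p ∈ S, p.Prime) →
      phiK K (∏ p ∈ S, p) = ∏ p ∈ S, phiK K p := by
    intro S
    induction S using Finset.induction_on with
    | empty => simp [phiK_one]
    | insert p S hpS ih =>
      intro hS
      rw [Finset.forall_mem_insert] at hS
      rw [Finset.prod_insert hpS, Finset.prod_insert hpS, phiK_mul, ih hS.2]
      refine Nat.Coprime.prod_right fun q hq ↦ (Nat.coprime_primes hS.1 (hS.2 q hq)).2 ?_
      rintro rfl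
      exact hpS hq
  rw [← key _ fun p hp ↦ Nat.prime_of_mem_primeFactors hp, Nat.prod_primeFactors_of_squarefree hd]

theorem prime_of_squarefree_of_phiK_dvd {K : Type*} [Field K] [NumberField K]
    (hn : 2 ≤ Module.finrank ℚ K) (hK : ∀ p : ℕ, p.Prime → Prime (p : 𝓞 K)) {d : ℕ}
    (hd2 : 2 ≤ d) (hd : Squarefree d) (h : phiK K d ∣ d ^ Module.finrank ℚ K - 1) :
    d.Prime := by
  set n := Module.finrank ℚ K
  have hlt : d ^ n < 2 * phiK K d := by
    have := prod_pow_lt_two_mul_prod_pow_sub_one hn d.primeFactors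
      fun p hp ↦ (Nat.prime_of_mem_primeFactors hp).two_le
    rw [Finset.prod_pow, Nat.prod_primeFactors_of_squarefree hd] at this
    rwa [phiK_eq_prod_of_squarefree K hd, Finset.prod_congr rfl fun p hp ↦
      phiK_of_prime (Nat.prime_of_mem_primeFactors hp).ne_zero
        (hK p (Nat.prime_of_mem_primeFactors hp))]
  obtain ⟨p, hp, m, rfl⟩ := Nat.exists_prime_and_dvd (by omega : d ≠ 1)
  have hm0 : m ≠ 0 := by rintro rfl; simp at hd2
  have hle : phiK K (p * m) ≤ (p ^ n - 1) * m ^ n := by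
    rw [phiK_mul K (Nat.squarefree_mul_iff.1 hd).1, phiK_of_prime hp.ne_zero (hK p hp)]
    refine Nat.mul_le_mul_left _ ?_
    rw [← card_quotient_span_natCast K m]
    have : Finite (𝓞 K ⧸ Ideal.span {(m : 𝓞 K)}) := Nat.finite_of_card_ne_zero
      (by rw [card_quotient_span_natCast]; exact pow_ne_zero _ hm0)
    exact Nat.card_le_card_of_injective _ Units.val_injective
  rw [Nat.sub_one_mul, ← mul_pow] at hle
  have hd1 : 1 < (p * m) ^ n := Nat.one_lt_pow (by omega) (by omega)
  have heq : phiK K (p * m) = (p * m) ^ n - 1 := by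
    obtain ⟨q, hq⟩ := h
    have : q < 2 := by
      by_contra! hq2
      have := Nat.mul_le_mul_left (phiK K (p * m)) hq2
      omega
    interval_cases q <;> omega
  have hm1 : m = 1 := by
    by_contra hm1
    have : 1 < m ^ n := Nat.one_lt_pow (by omega) (by omega)
    omega
  rwa [hm1, mul_one]

theorem stmt_12 (K : Type*) [Field K] [NumberField K]
    [IsPrincipalIdealRing (𝓞 K)] (hn : 2 ≤ Module.finrank ℚ K) :
    (∀ p : ℕ, p.Prime → Irreducible (p : 𝓞 K)) ↔
      ((∀ d : ℕ, 2 ≤ d → Squarefree d → IsLehmer K d) ∧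
        ∀ p : ℕ, p.Prime → IsNormalNum K p) := by
  constructor
  · intro hirr
    have hK : ∀ p : ℕ, p.Prime → Prime (p : 𝓞 K) := fun p hp ↦ (hirr p hp).prime
    refine ⟨fun d hd2 hd ↦ ⟨fun h ↦ hirr d (prime_of_squarefree_of_phiK_dvd hn hK hd2 hd h),
      fun h ↦ by rw [phiK_of_prime (by omega) h.prime]⟩, fun p hp ↦ ?_⟩
    rw [IsNormalNum, phiK_of_prime hp.ne_zero (hK p hp), Nat.totient_prime hp]
  · rintro ⟨hL, hN⟩ p hp
    refine (hL p hp.two_le hp.prime.squarefree).1 ?_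
    have h := Nat.mul_dvd_mul_left p.totient (hN p hp)
    rw [Nat.mul_div_cancel' (totient_dvd_phiK hp (by omega)), Nat.totient_prime hp,
      Nat.mul_div_cancel' (Nat.sub_one_dvd_pow_sub_one p _)] at h
    exact h
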